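/- arXiv:2304.01528 — 2 statements merged into one kernel-verified Lean document; each statement's English description precedes it below -/
import Mathlib

section
/- Let A, B ∈ ℚ with 4A³ + 27B² ≠ 0, and let (U, D, T) ∈ ℚ³ with T ≠ 0 and D ≠ 0 satisfy TD² = 4(T³+AT+B)U³ − T(27T⁴ + 30AT² − A² + 36BT)U² − 6T²(4A²T − 9BT² + 3AB)U − (4A³+27B²)T³. If the cubic polynomial T·x³ − U·x² + T(A+2U)·x + T(B−TU) is irreducible over ℚ, then its splitting field over ℚ is a Galois extension of degree 3 with cyclic Galois group. -/
open Polynomial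

/-- The cubic `T·x³ − U·x² + T(A+2U)·x + T(B−TU)` over `ℚ`. -/
noncomputable def cubicPoly (A B U T : ℚ) : Polynomial ℚ :=
  C T * X ^ 3 - C U * X ^ 2 + C (T * (A + 2 * U)) * X + C (T * (B - T * U))

open IntermediateField in
/-- Over a field of characteristic zero, the roots of a cubic with nonzero square discriminant are
rational functions of any one of them. -/
theorem Cubic.mem_adjoin_of_roots {F K : Type*} [Field F] [CharZero F] [Field K] [Algebra F K]
    {P : Cubic F} (ha : P.a ≠ 0) {δ : F} (hδ : δ ≠ 0) (hdisc : P.discr = δ ^ 2) {x y z : K}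
    (h3 : (P.map (algebraMap F K)).roots = {x, y, z}) : y ∈ F⟮x⟯ ∧ z ∈ F⟮x⟯ := by
  have : CharZero K := charZero_of_injective_algebraMap (algebraMap F K).injective
  set φ := algebraMap F K
  have hb := b_eq_three_roots ha h3
  have hc := c_eq_three_roots ha h3
  have hD := discr_eq_prod_three_roots ha h3
  have ha' : φ P.a ≠ 0 := by simpa using ha
  have hδ' : φ δ ≠ 0 := by simpa using hδ
  rw [hdisc, map_pow] at hD
  have hxm : x ∈ F⟮x⟯ := mem_adjoin_simple_self F x
  have hφ (t : F) : φ t ∈ F⟮x⟯ := F⟮x⟯.algebraMap_mem t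
  have hsum : y + z ∈ F⟮x⟯ := by
    have : y + z = -(φ P.b / φ P.a) - x := by rw [hb]; field_simp; ring
    rw [this]
    exact sub_mem (neg_mem (div_mem (hφ _) (hφ _))) hxm
  have hprod : y * z ∈ F⟮x⟯ := by
    have : y * z = φ P.c / φ P.a - x * (y + z) := by rw [hc]; field_simp; ring
    rw [this]
    exact sub_mem (div_mem (hφ _) (hφ _)) (mul_mem hxm hsum)
  have hne : (x - y) * (x - z) ≠ 0 := by
    intro h
    apply pow_ne_zero 2 hδ'
    rw [hD]
    linear_combination φ P.a ^ 4 * (x - y) * (x - z) * (y - z) ^ 2 * h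
  have hder : (x - y) * (x - z) ∈ F⟮x⟯ := by
    have : (x - y) * (x - z) = x ^ 2 - x * (y + z) + y * z := by ring
    rw [this]
    exact add_mem (sub_mem (pow_mem hxm 2) (mul_mem hxm hsum)) hprod
  have hdiff : y - z ∈ F⟮x⟯ := by
    have hmem : φ δ / (φ P.a ^ 2 * ((x - y) * (x - z))) ∈ F⟮x⟯ :=
      div_mem (hφ _) (mul_mem (pow_mem (hφ _) 2) hder)
    have hden : φ P.a ^ 2 * ((x - y) * (x - z)) ≠ 0 := mul_ne_zero (pow_ne_zero 2 ha') hne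
    rcases sq_eq_sq_iff_eq_or_eq_neg.mp hD with h | h
    · rwa [h, show φ P.a * φ P.a * (x - y) * (x - z) * (y - z)
        = (y - z) * (φ P.a ^ 2 * ((x - y) * (x - z))) by ring, mul_div_cancel_right₀ _ hden] at hmem
    · rw [h, show -(φ P.a * φ P.a * (x - y) * (x - z) * (y - z))
        = -(y - z) * (φ P.a ^ 2 * ((x - y) * (x - z))) by ring, mul_div_cancel_right₀ _ hden] at hmem
      exact neg_mem_iff.mp hmem
  have htwo : (2 : K) ∈ F⟮x⟯ := ofNat_mem _ 2
  constructor
  · have : y = ((y + z) + (y - z)) / 2 := by ring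
    rw [this]
    exact div_mem (add_mem hsum hdiff) htwo
  · have : z = ((y + z) - (y - z)) / 2 := by ring
    rw [this]
    exact div_mem (sub_mem hsum hdiff) htwo

open IntermediateField in
/-- A splitting field of an irreducible cubic with nonzero square discriminant has degree three. -/
theorem Cubic.finrank_eq_three_of_isSplittingField {F K : Type*} [Field F] [CharZero F] [Field K]
    [Algebra F K] {P : Cubic F} [IsSplittingField F K P.toPoly] (ha : P.a ≠ 0)
    (hirr : Irreducible P.toPoly) {δ : F} (hδ : δ ≠ 0) (hdisc : P.discr = δ ^ 2) :
    Module.finrank F K = 3 := by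
  have : FiniteDimensional F K := IsSplittingField.finiteDimensional K P.toPoly
  obtain ⟨x, y, z, h3⟩ := (splits_iff_roots_eq_three ha).mp (IsSplittingField.splits K P.toPoly)
  obtain ⟨hy, hz⟩ := mem_adjoin_of_roots ha hδ hdisc h3
  have hmem (w : K) : w ∈ P.toPoly.rootSet K ↔ w ∈ (P.map (algebraMap F K)).roots := by
    rw [mem_rootSet', Cubic.map_roots, mem_roots', IsRoot.def, eval_map_algebraMap]
  have htop : F⟮x⟯ = ⊤ := by
    rw [← toSubalgebra_inj, top_toSubalgebra, eq_top_iff,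
      ← IsSplittingField.adjoin_rootSet K P.toPoly, Algebra.adjoin_le_iff]
    intro w hw
    have hw' := (hmem w).mp hw
    rw [h3] at hw'
    simp only [Multiset.insert_eq_cons, Multiset.mem_cons, Multiset.mem_singleton] at hw'
    rcases hw' with rfl | rfl | rfl
    exacts [mem_adjoin_simple_self F _, hy, hz]
  have hx : aeval x P.toPoly = 0 :=
    (mem_rootSet'.mp ((hmem x).mpr (by simp [h3]))).2
  rw [← finrank_top', ← htop, adjoin.finrank (Algebra.IsIntegral.isIntegral x),
    ← minpoly.eq_of_irreducible hirr hx,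
    natDegree_mul_C (inv_ne_zero (leadingCoeff_ne_zero.mpr hirr.ne_zero)),
    natDegree_of_a_ne_zero ha]

theorem cubicPoly_eq_toPoly (A B U T : ℚ) :
    cubicPoly A B U T = (⟨T, -U, T * (A + 2 * U), T * (B - T * U)⟩ : Cubic ℚ).toPoly := by
  simp [cubicPoly, Cubic.toPoly, sub_eq_add_neg]

theorem splittingField_of_cubic_is_cyclic_cubic (A B U D T : ℚ)
    (hΔ : 4 * A ^ 3 + 27 * B ^ 2 ≠ 0) (hT : T ≠ 0) (hD : D ≠ 0)
    (hS : T * D ^ 2 =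
      4 * (T ^ 3 + A * T + B) * U ^ 3
        - T * (27 * T ^ 4 + 30 * A * T ^ 2 - A ^ 2 + 36 * B * T) * U ^ 2
        - 6 * T ^ 2 * (4 * A ^ 2 * T - 9 * B * T ^ 2 + 3 * A * B) * U
        - (4 * A ^ 3 + 27 * B ^ 2) * T ^ 3)
    (hirr : Irreducible (cubicPoly A B U T)) :
    IsGalois ℚ (cubicPoly A B U T).SplittingField ∧
      Module.finrank ℚ (cubicPoly A B U T).SplittingField = 3 ∧
      IsCyclic ((cubicPoly A B U T).SplittingField ≃ₐ[ℚ] (cubicPoly A B U T).SplittingField) := by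
  have hsplit : IsSplittingField ℚ (cubicPoly A B U T).SplittingField (cubicPoly A B U T) := by
    convert IsSplittingField.splittingField (cubicPoly A B U T)
    exact Subsingleton.elim _ _
  have hgal : IsGalois ℚ (cubicPoly A B U T).SplittingField :=
    IsGalois.of_separable_splitting_field (p := cubicPoly A B U T) hirr.separable
  have hdeg : Module.finrank ℚ (cubicPoly A B U T).SplittingField = 3 := by
    rw [cubicPoly_eq_toPoly] at hirr hsplit ⊢
    refine Cubic.finrank_eq_three_of_isSplittingField hT hirr (mul_ne_zero hT hD) ?_
    simp only [Cubic.discr]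
    linear_combination -T * hS
  have : Fact (Nat.Prime 3) := ⟨Nat.prime_three⟩
  exact ⟨hgal, hdeg, isCyclic_of_prime_card ((IsGalois.card_aut_eq_finrank _ _).trans hdeg)⟩
end

section
/- Let m and n be nonzero coprime integers with 3 ∤ m and m² + 3n² squarefree. Then the cubic polynomial f(x) = 12n²·x³ − 9(m² + 3n²)·x² + 6(m² + 3n²)·x − (m² + 3n²) is irreducible over ℚ, and its splitting field over ℚ is a Galois extension of degree 3 with cyclic Galois group. -/
open Polynomial

/-- The cubic `12n²·x³ − 9(m²+3n²)·x² + 6(m²+3n²)·x − (m²+3n²)` over `ℚ`. -/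
noncomputable def cubicMN (m n : ℤ) : Polynomial ℚ :=
  C (12 * (n : ℚ) ^ 2) * X ^ 3 - C (9 * ((m : ℚ) ^ 2 + 3 * (n : ℚ) ^ 2)) * X ^ 2
    + C (6 * ((m : ℚ) ^ 2 + 3 * (n : ℚ) ^ 2)) * X - C ((m : ℚ) ^ 2 + 3 * (n : ℚ) ^ 2)

/-- The homogenised equation `12n²a³ = (m²+3n²)(9a²b-6ab²+b³)` has no coprime solution: a prime
factor of `m²+3n²` would divide both `a` and `b`. -/
lemma no_coprime_solution_cubicMN (m n : ℤ) (hm : m ≠ 0) (hn : n ≠ 0) (hcop : IsCoprime m n)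
    (h3 : ¬(3 ∣ m)) (hsf : Squarefree (m ^ 2 + 3 * n ^ 2)) (a b : ℤ) (hab : IsCoprime a b) :
    12 * n ^ 2 * a ^ 3 ≠ (m ^ 2 + 3 * n ^ 2) * (9 * a ^ 2 * b - 6 * a * b ^ 2 + b ^ 3) := by
  intro h
  have hm' : 0 < m ^ 2 := by positivity
  have hn' : 0 < n ^ 2 := by positivity
  obtain ⟨p, hp, hpD⟩ := Int.exists_prime_and_dvd (n := m ^ 2 + 3 * n ^ 2) (by omega)
  have hpn : ¬ p ∣ n := by
    intro hpn
    have hpm : p ∣ m := by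
      refine hp.dvd_of_dvd_pow (n := 2) ?_
      exact (dvd_add_left ((hpn.pow two_ne_zero).mul_left 3)).1 hpD
    exact hp.not_isUnit (hcop.isUnit_of_dvd' hpm hpn)
  have hp3 : ¬ p ∣ 3 := by
    intro hp3
    have hpm : p ∣ m := hp.dvd_of_dvd_pow ((dvd_add_left (hp3.mul_right (n ^ 2))).1 hpD)
    exact h3 (((hp.associated_of_dvd Int.prime_three hp3).dvd_iff_dvd_left).1 hpm)
  have hp2 : ¬ p ∣ 2 := by
    intro hp2
    have h2D : 2 ∣ m ^ 2 + 3 * n ^ 2 :=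
      ((hp.associated_of_dvd Int.prime_two hp2).dvd_iff_dvd_left).1 hpD
    have h2n : ¬ 2 ∣ n := fun h ↦
      hpn (((hp.associated_of_dvd Int.prime_two hp2).dvd_iff_dvd_left).2 h)
    have h4 : (2 : ℤ) * 2 ∣ m ^ 2 + 3 * n ^ 2 := by
      obtain ⟨k, rfl⟩ : Odd n := by rwa [← Int.not_even_iff_odd, even_iff_two_dvd]
      rcases Int.even_or_odd' m with ⟨j, rfl | rfl⟩
      · ring_nf at h2D
        omega
      · exact ⟨j ^ 2 + j + 3 * k ^ 2 + 3 * k + 1, by ring⟩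
    exact Int.prime_two.not_isUnit (hsf 2 h4)
  have hpa : p ∣ a := by
    have h1 : p ∣ 2 * 2 * 3 * n ^ 2 * a ^ 3 := by
      have : p ∣ 12 * n ^ 2 * a ^ 3 := h ▸ hpD.mul_right _
      simpa using this
    rcases hp.dvd_or_dvd h1 with h1 | h1
    · rcases hp.dvd_or_dvd h1 with h1 | h1
      · rcases hp.dvd_or_dvd h1 with h1 | h1
        · exact absurd (hp.dvd_or_dvd h1) (by tauto)
        · exact absurd h1 hp3
      · exact absurd (hp.dvd_of_dvd_pow h1) hpn
    · exact hp.dvd_of_dvd_pow h1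
  obtain ⟨c, rfl⟩ := hpa
  obtain ⟨d, hd⟩ := hpD
  have hpd : ¬ p ∣ d := by
    rintro ⟨e, rfl⟩
    exact hp.not_isUnit (hsf p ⟨e, by rw [hd]; ring⟩)
  rw [hd] at h
  have h2 : p * (12 * n ^ 2 * p * c ^ 3 * p) =
      p * (d * (9 * (p * c) ^ 2 * b - 6 * (p * c) * b ^ 2 + b ^ 3)) := by
    linear_combination h
  have h2' := mul_left_cancel₀ hp.ne_zero h2
  have hpb : p ∣ d * b ^ 3 :=
    ⟨12 * n ^ 2 * p * c ^ 3 - d * (9 * p * c ^ 2 * b - 6 * c * b ^ 2), by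
      linear_combination -h2'⟩
  rcases hp.dvd_or_dvd hpb with h | h
  · exact hpd h
  · exact hp.not_isUnit (hab.isUnit_of_dvd' (dvd_mul_right p c) (hp.dvd_of_dvd_pow h))

lemma natDegree_cubicMN (m n : ℤ) (hn : n ≠ 0) : (cubicMN m n).natDegree = 3 := by
  have : (12 * (n : ℚ) ^ 2) ≠ 0 := by positivity
  unfold cubicMN
  compute_degree!

lemma irreducible_cubicMN (m n : ℤ) (hm : m ≠ 0) (hn : n ≠ 0) (hcop : IsCoprime m n)
    (h3 : ¬(3 ∣ m)) (hsf : Squarefree (m ^ 2 + 3 * n ^ 2)) : Irreducible (cubicMN m n) := by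
  have hdeg := natDegree_cubicMN m n hn
  refine (irreducible_iff_roots_eq_zero_of_degree_le_three (by omega) (by omega)).2 ?_
  refine Multiset.eq_zero_of_forall_notMem fun q hq ↦ ?_
  have hq' := (mem_roots'.1 hq).2
  simp only [cubicMN, IsRoot.def, eval_sub, eval_add, eval_mul, eval_C, eval_pow, eval_X] at hq'
  refine no_coprime_solution_cubicMN m n hm hn hcop h3 hsf q.num q.den
    (Int.isCoprime_iff_gcd_eq_one.2 q.reduced) ?_
  have hden : (q.den : ℚ) ≠ 0 := by exact_mod_cast q.den_ne_zero
  have hnum : q * q.den = q.num := Rat.mul_den_eq_num q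
  have : (12 * n ^ 2 * q.num ^ 3 : ℚ) = (m ^ 2 + 3 * n ^ 2) *
      (9 * q.num ^ 2 * q.den - 6 * q.num * q.den ^ 2 + q.den ^ 3) := by
    rw [← hnum]
    linear_combination (q.den : ℚ) ^ 3 * hq'
  exact_mod_cast this

/-- Any subfield containing one root of `cubicMN m n` contains all of them. -/
lemma mem_of_aeval_cubicMN_eq_zero {L : Type*} [Field L] [Algebra ℚ L] (K : IntermediateField ℚ L)
    (m n : ℤ) (hm : m ≠ 0) (hn : n ≠ 0) {x y : L} (hxK : x ∈ K)
    (hx : aeval x (cubicMN m n) = 0) (hy : aeval y (cubicMN m n) = 0) : y ∈ K := by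
  have : CharZero L := algebraRat.charZero L
  simp only [cubicMN, map_sub, map_add, map_mul, aeval_X, map_pow, map_ofNat,
    map_intCast] at hx hy
  have hmL : (m : L) ≠ 0 := by exact_mod_cast hm
  have hnL : (n : L) ≠ 0 := by exact_mod_cast hn
  have hD : (m : L) ^ 2 + 3 * (n : L) ^ 2 ≠ 0 := by
    have : m ^ 2 + 3 * n ^ 2 ≠ 0 := by positivity
    exact_mod_cast this
  set D : L := (m : L) ^ 2 + 3 * (n : L) ^ 2 with hDdef
  have hx0 : x ≠ 0 := by rintro rfl; apply hD; linear_combination -hx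
  have hy0 : y ≠ 0 := by rintro rfl; apply hD; linear_combination -hy
  obtain ⟨z, hz⟩ : ∃ z, z = x⁻¹ - 2 := ⟨_, rfl⟩
  obtain ⟨u, hu⟩ : ∃ u, u = y⁻¹ - 2 := ⟨_, rfl⟩
  have key : ∀ {t w : L}, t ≠ 0 → w = t⁻¹ - 2 →
      12 * (n : L) ^ 2 * t ^ 3 - 9 * D * t ^ 2 + 6 * D * t - D = 0 →
      D * (w ^ 3 - 3 * w) = 6 * (n : L) ^ 2 - 2 * (m : L) ^ 2 := by
    intro t w ht hw h
    have hwt : t⁻¹ = w + 2 := by rw [hw]; ring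
    have ht' : t = (w + 2)⁻¹ := by rw [← hwt, inv_inv]
    have hw2 : w + 2 ≠ 0 := by rw [← hwt]; exact inv_ne_zero ht
    rw [ht'] at h
    field_simp at h
    rw [hDdef] at h ⊢
    linear_combination -h
  have hzK : z ∈ K := hz ▸ sub_mem (inv_mem hxK) (ofNat_mem K 2)
  suffices huK : u ∈ K by
    have : y = (u + 2)⁻¹ := by rw [hu]; simp
    rw [this]
    exact inv_mem (add_mem huK (ofNat_mem K 2))
  have hz3 := key hx0 hz hx
  have hu3 := key hy0 hu hy
  by_cases huz : u = z
  · exact huz ▸ hzK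
  have hquad : u ^ 2 + u * z + z ^ 2 - 3 = 0 := by
    have : D * (u - z) * (u ^ 2 + u * z + z ^ 2 - 3) = 0 := by linear_combination hu3 - hz3
    simpa [hD, sub_ne_zero.2 huz] using this
  have hsq : ((2 * u + z) * (D * (z ^ 2 - 1))) ^ 2 = (12 * (m : L) * n) ^ 2 := by
    linear_combination 4 * D ^ 2 * (z ^ 2 - 1) ^ 2 * hquad
      - 3 * (D * (z ^ 3 - 3 * z) + (6 * (n : L) ^ 2 - 2 * (m : L) ^ 2)) * hz3
      + 12 * (D + ((m : L) ^ 2 + 3 * (n : L) ^ 2)) * hDdef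
  have hE : D * (z ^ 2 - 1) ≠ 0 := by
    intro h
    rw [h] at hsq
    rw [mul_zero, zero_pow two_ne_zero] at hsq
    exact pow_ne_zero 2 (mul_ne_zero (mul_ne_zero (by norm_num) hmL) hnL) hsq.symm
  have hDK : D ∈ K := by rw [hDdef]; aesop
  have hEK : D * (z ^ 2 - 1) ∈ K := mul_mem hDK (sub_mem (pow_mem hzK 2) (one_mem K))
  have hcK : 12 * (m : L) * n ∈ K :=
    mul_mem (mul_mem (ofNat_mem K 12) (intCast_mem K m)) (intCast_mem K n)
  have hprod : (2 * u + z) * (D * (z ^ 2 - 1)) ∈ K := by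
    rcases sq_eq_sq_iff_eq_or_eq_neg.1 hsq with h | h
    · exact h ▸ hcK
    · exact h ▸ neg_mem hcK
  have : u = ((2 * u + z) * (D * (z ^ 2 - 1)) / (D * (z ^ 2 - 1)) - z) / 2 := by
    rw [mul_div_cancel_right₀ _ hE]; ring
  rw [this]
  exact div_mem (sub_mem (div_mem hprod hEK) hzK) (ofNat_mem K 2)

lemma finrank_of_isSplittingField_cubicMN {L : Type*} [Field L] [Algebra ℚ L] (m n : ℤ)
    (hm : m ≠ 0) (hn : n ≠ 0) (hirr : Irreducible (cubicMN m n))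
    (hL : IsSplittingField ℚ L (cubicMN m n)) : Module.finrank ℚ L = 3 := by
  have hdeg := natDegree_cubicMN m n hn
  have hd0 : ((cubicMN m n).map (algebraMap ℚ L)).degree ≠ 0 := by
    rw [degree_map]
    exact fun h ↦ by simp [natDegree_eq_of_degree_eq_some h] at hdeg
  obtain ⟨x, hx⟩ := hL.splits.exists_eval_eq_zero hd0
  rw [eval_map_algebraMap] at hx
  have htop : IntermediateField.adjoin ℚ {x} = ⊤ := by
    rw [eq_top_iff, ← IntermediateField.toSubalgebra_le_toSubalgebra,
      IntermediateField.top_toSubalgebra, ← hL.adjoin_rootSet, Algebra.adjoin_le_iff]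
    intro y hy
    exact mem_of_aeval_cubicMN_eq_zero _ m n hm hn
      (IntermediateField.mem_adjoin_simple_self ℚ x) hx (mem_rootSet.1 hy).2
  have : FiniteDimensional ℚ L := IsSplittingField.finiteDimensional L (cubicMN m n)
  have hint : IsIntegral ℚ x := Algebra.IsIntegral.isIntegral x
  rw [← IntermediateField.finrank_top', ← htop, IntermediateField.adjoin.finrank hint,
    ← hdeg, ← minpoly.eq_of_irreducible hirr hx,
    natDegree_mul_C (inv_ne_zero (leadingCoeff_ne_zero.2 hirr.ne_zero))]

theorem cubicMN_irreducible_cyclic_splitting_field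
    (m n : ℤ) (hm : m ≠ 0) (hn : n ≠ 0) (hcop : IsCoprime m n)
    (h3 : ¬(3 ∣ m)) (hsf : Squarefree (m ^ 2 + 3 * n ^ 2)) :
    Irreducible (cubicMN m n) ∧
      IsGalois ℚ (cubicMN m n).SplittingField ∧
      Module.finrank ℚ (cubicMN m n).SplittingField = 3 ∧
      IsCyclic ((cubicMN m n).SplittingField ≃ₐ[ℚ] (cubicMN m n).SplittingField) := by
  have hirr := irreducible_cubicMN m n hm hn hcop h3 hsf
  have hsplit : IsSplittingField ℚ (cubicMN m n).SplittingField (cubicMN m n) := by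
    convert IsSplittingField.splittingField (cubicMN m n)
    exact Subsingleton.elim _ _
  have hrank := finrank_of_isSplittingField_cubicMN m n hm hn hirr hsplit
  have hgal : IsGalois ℚ (cubicMN m n).SplittingField :=
    IsGalois.of_separable_splitting_field hirr.separable
  have : Fact (Nat.Prime 3) := ⟨Nat.prime_three⟩
  have : FiniteDimensional ℚ (cubicMN m n).SplittingField :=
    Module.finite_of_finrank_pos (by omega)
  exact ⟨hirr, hgal, hrank,
    isCyclic_of_prime_card (p := 3) (by rw [IsGalois.card_aut_eq_finrank, hrank])⟩
end
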